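/- Let T_0 ∈ (π, 2π) and let n ∈ ℕ, n ≥ 1, be the unique integer such that (n+2)π/(n+1) ≤ T_0 < (n+1)π/n. Then T_opt(T_0) = (n+2)π; in particular the set { t > 0 : μ((D(T_0,t))ᶜ) = 0 } is nonempty. -/

import Mathlib

open MeasureTheory Set Real Filter Topology

noncomputable section

instance : Fact (0 < 2 * Real.pi) := ⟨by positivity⟩

/-- λ_k: 0 for even k, π for odd k. -/
def lam (k : ℕ) : ℝ := if Even k then 0 else Real.pi

/-- Covered set D(T₀, t) ⊆ ℝ/(2πℤ): the union over k of the projections of the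
observation intervals (k·T₀, min((k+1)·T₀, t)) translated by −λ_k. -/
def coveredSet (T0 t : ℝ) : Set (AddCircle (2 * Real.pi)) :=
  ⋃ k : ℕ, (fun a : ℝ => ((a - lam k : ℝ) : AddCircle (2 * Real.pi))) ''
    Set.Ioo ((k : ℝ) * T0) (min (((k : ℝ) + 1) * T0) t)

/-- Optimal control time T_opt(T₀). -/
def Topt (T0 : ℝ) : ℝ :=
  sInf { t : ℝ | 0 < t ∧ volume (coveredSet T0 t)ᶜ = 0 }

lemma aux_coe (k : ℕ) (a : ℝ) :
    ((a - lam k : ℝ) : AddCircle (2 * Real.pi)) = ((a - k * Real.pi : ℝ) : AddCircle (2 * Real.pi)) := by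
  rw [← sub_eq_zero, ← AddCircle.coe_sub, AddCircle.coe_eq_zero_iff]
  rcases Nat.even_or_odd k with h | h
  · obtain ⟨m, rfl⟩ := h
    refine ⟨m, ?_⟩
    simp only [lam, Even.add_self, if_true, zsmul_eq_mul]
    push_cast
    ring
  · have h' : ¬ Even k := Nat.not_even_iff_odd.mpr h
    obtain ⟨m, rfl⟩ := h
    refine ⟨m, ?_⟩
    simp only [lam, h', if_false, zsmul_eq_mul]
    push_cast
    ring

theorem stmt_7 (T0 : ℝ) (hT0 : T0 ∈ Set.Ioo Real.pi (2 * Real.pi))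
    (n : ℕ) (hn : 1 ≤ n)
    (h1 : ((n : ℝ) + 2) * Real.pi / ((n : ℝ) + 1) ≤ T0)
    (h2 : T0 < ((n : ℝ) + 1) * Real.pi / (n : ℝ)) :
    { t : ℝ | 0 < t ∧ volume (coveredSet T0 t)ᶜ = 0 }.Nonempty ∧
      Topt T0 = ((n : ℝ) + 2) * Real.pi := by
  have hpi := Real.pi_pos
  obtain ⟨hl, hu⟩ := hT0
  have hn' : (1 : ℝ) ≤ n := by exact_mod_cast hn
  rw [div_le_iff₀ (by linarith)] at h1
  rw [lt_div_iff₀ (by linarith)] at h2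
  have hleast : IsLeast { t : ℝ | 0 < t ∧ volume (coveredSet T0 t)ᶜ = 0 }
      (((n : ℝ) + 2) * Real.pi) := by
    constructor
    · refine ⟨by positivity, ?_⟩
      refine measure_mono_null (t := {((0 : ℝ) : AddCircle (2 * Real.pi))}) ?_ (by
        have := AddCircle.volume_closedBall (2 * Real.pi) (x := ((0 : ℝ) : AddCircle (2 * Real.pi))) 0
        rw [Metric.closedBall_zero] at this
        rw [this]
        simp [hpi.le])
      intro y hy
      by_contra hy0
      apply hy
      obtain ⟨x, hx, rfl⟩ : ∃ x ∈ Ico (0 : ℝ) (0 + 2 * Real.pi), (x : AddCircle (2 * Real.pi)) = y := by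
        have := AddCircle.coe_image_Ico_eq (2 * Real.pi) 0
        have h : y ∈ ((↑) : ℝ → AddCircle (2 * Real.pi)) '' Ico 0 (0 + 2 * Real.pi) := by
          rw [this]; trivial
        exact h
      have hx0 : 0 < x := by
        rcases hx.1.lt_or_eq with h | h
        · exact h
        · exact absurd (by rw [← h]; rfl) hy0
      have hx2 : x < 2 * Real.pi := by linarith [hx.2]
      unfold coveredSet
      rw [mem_iUnion]
      by_cases hc : n * T0 - n * Real.pi < x
      · refine ⟨n, x + n * Real.pi, ⟨by linarith, lt_min ?_ ?_⟩, ?_⟩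
        · nlinarith
        · nlinarith
        · simp only [aux_coe]
          congr 1
          ring
      · refine ⟨0, x, ⟨by simpa using hx0, lt_min ?_ ?_⟩, ?_⟩
        · push_cast; nlinarith
        · nlinarith
        · simp [lam]
    · rintro t ⟨ht, hv⟩
      by_contra hlt
      push Not at hlt
      set M := max (n * T0 - (n - 1) * Real.pi) (t - n * Real.pi) with hM
      have hM2 : M < 2 * Real.pi := max_lt (by nlinarith) (by nlinarith)
      have hM0 : 0 < M := lt_of_lt_of_le (by nlinarith) (le_max_left _ _)
      have hopen : IsOpen (((↑) : ℝ → AddCircle (2 * Real.pi)) '' Ioo M (2 * Real.pi)) :=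
        QuotientAddGroup.isOpenMap_coe _ isOpen_Ioo
      have hpos := hopen.measure_pos volume ((nonempty_Ioo.2 hM2).image _)
      refine hpos.ne' (measure_mono_null ?_ hv)
      rintro _ ⟨b, hb, rfl⟩ hcov
      unfold coveredSet at hcov
      rw [mem_iUnion] at hcov
      obtain ⟨k, a, ⟨ha1, ha2⟩, hab⟩ := hcov
      simp only [aux_coe] at hab
      obtain ⟨ha2, ha3⟩ := lt_min_iff.1 ha2
      have hkn : k ≤ n := by
        by_contra hk
        push Not at hk
        have : (n : ℝ) + 1 ≤ k := by exact_mod_cast hk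
        nlinarith
      have hk0 : (0 : ℝ) ≤ k := Nat.cast_nonneg k
      have hA0 : 0 < a - k * Real.pi := by nlinarith
      have hAM : a - k * Real.pi ≤ M := by
        rcases hkn.lt_or_eq with h | h
        · have : (k : ℝ) + 1 ≤ n := by exact_mod_cast h
          refine le_trans ?_ (le_max_left _ _)
          nlinarith
        · subst h
          exact le_trans (by linarith) (le_max_right _ _)
      have := (AddCircle.coe_eq_coe_iff_of_mem_Ico (p := 2 * Real.pi) (a := 0)
        ⟨hA0.le, by linarith⟩ ⟨by linarith [hb.1], by linarith [hb.2]⟩).1 hab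
      linarith [hb.1]
  exact ⟨⟨_, hleast.1⟩, hleast.csInf_eq⟩
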